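/- Under the stated hypotheses on Φ and f (a local diffeomorphism with triangular component structure, with X2 = x2·K, X3 = x3·H, X5 = x5·G, conjugating Z'_{1,c} to f·(Z'_{1,c̃}∘Φ) modulo span{∂_{x5}, ∂_{y5}}), one necessarily has c = c̃. -/

import Mathlib

noncomputable section

/-- The model space `ℝ^13` with coordinates
`(t, x0, y0, x1, y1, x2, y2, x3, y3, x4, y4, x5, y5)`
indexed by `0, 1, ..., 12` respectively. -/
abbrev E13 := Fin 13 → ℝ

/-- The constant coordinate vector field `∂_u` of the `i`-th coordinate. -/
def e (i : Fin 13) : E13 := Pi.single i 1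

/-- Partial derivative of a scalar function `F` in the `i`-th coordinate
direction, at a point `p`. -/
def pd (F : E13 → ℝ) (i : Fin 13) (p : E13) : ℝ := fderiv ℝ F p (e i)

/-- The vector field `Z'_{1,a}` of the EKR pseudo-normal form for the
singularity class 1.2.2.1.2:
`Z'_{1,a} = ∂_{x4} + (a + y5)·∂_{y4} + x5·( ∂_{x2} + y3·∂_{y2} + (1 + x4)·∂_{x3}
 + (1 + y4)·∂_{y3} + x3·( ∂_{x1} + y2·∂_{y1} + x2·( ∂_t + x1·∂_{x0} + y1·∂_{y0} ) ) )`. -/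
def Z (a : ℝ) (p : E13) : E13 :=
  e 9 + (a + p 12) • e 10 +
    p 11 • (e 5 + p 8 • e 6 + (1 + p 9) • e 7 + (1 + p 10) • e 8 +
      p 7 • (e 3 + p 6 • e 4 + p 5 • (e 0 + p 3 • e 1 + p 4 • e 2)))

/-- A coordinate factor can be cancelled from an identity between continuous functions. -/
lemma eqOn_of_coord_mul_eq {U : Set E13} (hU : IsOpen U) (k : Fin 13) {g h : E13 → ℝ}
    (hg : ContinuousOn g U) (hh : ContinuousOn h U)
    (heq : ∀ p ∈ U, p k * g p = p k * h p) : ∀ p ∈ U, g p = h p := by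
  intro p hp
  by_cases hk : p k = 0
  · have hline : Filter.Tendsto (fun s : ℝ => p + s • e k) (nhdsWithin 0 {0}ᶜ) (nhds p) := by
      have : Continuous fun s : ℝ => p + s • e k := by fun_prop
      have h0 := this.tendsto 0
      simp only [zero_smul, add_zero] at h0
      exact h0.mono_left nhdsWithin_le_nhds
    have hgt := (hg.continuousAt (hU.mem_nhds hp)).tendsto.comp hline
    have hht := (hh.continuousAt (hU.mem_nhds hp)).tendsto.comp hline
    refine tendsto_nhds_unique (hgt.congr' ?_) hht
    filter_upwards [hline.eventually (hU.mem_nhds hp), self_mem_nhdsWithin] with s hs hs0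
    have hsk : (p + s • e k) k = s := by simp [e, hk]
    have hmul := heq _ hs
    rw [hsk] at hmul
    exact mul_left_cancel₀ hs0 hmul
  · exact mul_left_cancel₀ hk (heq p hp)

lemma pd_smul_of_invariant {F : E13 → ℝ} {k : Fin 13}
    (hF : ∀ (p : E13) (s : ℝ), F (p + s • e k) = F p) (j : Fin 13) (s : ℝ) :
    pd F j (s • e k) = pd F j 0 := by
  have h : (fun p => F (p + s • e k)) = F := funext fun p => hF p s
  unfold pd
  conv_rhs => rw [← h, fderiv_comp_add_right, zero_add]

lemma hasDerivAt_line {F : E13 → ℝ} {p : E13} (hF : DifferentiableAt ℝ F p) (k : Fin 13) :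
    HasDerivAt (fun s : ℝ => F (p + s • e k)) (pd F k p) 0 :=
  hF.hasFDerivAt.hasLineDerivAt (e k)

lemma hasDerivAt_axis {F : E13 → ℝ} {k : Fin 13} {s : ℝ}
    (hF : DifferentiableAt ℝ F (s • e k)) :
    HasDerivAt (fun r : ℝ => F (r • e k)) (pd F k (s • e k)) s := by
  have hline : HasDerivAt (fun r : ℝ => r • e k) (e k) s := by
    simpa using (hasDerivAt_id s).smul_const (e k)
  exact hF.hasFDerivAt.comp_hasDerivAt s hline

lemma pd_eq_zero_of_invariant {F : E13 → ℝ} {k : Fin 13}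
    (hF : ∀ (p : E13) (s : ℝ), F (p + s • e k) = F p) (p : E13) : pd F k p = 0 := by
  by_cases hd : DifferentiableAt ℝ F p
  · have h := hasDerivAt_line hd k
    simp only [hF] at h
    exact h.unique (hasDerivAt_const _ _)
  · simp [pd, fderiv_zero_of_not_differentiableAt hd]

lemma pd_zero_of_axis_eq {F : E13 → ℝ} {k : Fin 13} {a : ℝ}
    (hF : DifferentiableAt ℝ F 0) (h : ∀ᶠ s : ℝ in nhds 0, F (s • e k) = a * s) :
    pd F k 0 = a := by
  have h1 := hasDerivAt_axis (k := k) (s := 0) (by simpa using hF)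
  have h2 : HasDerivAt (fun s : ℝ => a * s) a 0 := by
    simpa using (hasDerivAt_id (0 : ℝ)).const_mul a
  simpa using (h1.congr_of_eventuallyEq (h.mono fun _ hs => hs.symm)).unique h2

lemma eventually_pd_axis_eq_zero {F : E13 → ℝ} {U : Set E13} (hU : IsOpen U)
    (h0 : (0 : E13) ∈ U) (hF : DifferentiableOn ℝ F U) {k : Fin 13}
    (h : ∀ᶠ s : ℝ in nhds 0, F (s • e k) = 0) :
    ∀ᶠ s : ℝ in nhds 0, pd F k (s • e k) = 0 := by
  have hline : Continuous fun s : ℝ => s • e k := by fun_prop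
  have hmem : ∀ᶠ s : ℝ in nhds 0, s • e k ∈ U :=
    hline.continuousAt.eventually (hU.mem_nhds (by simpa using h0))
  filter_upwards [h.eventually_nhds, hmem] with s hs hsU
  have h1 := hasDerivAt_axis (hF.differentiableAt (hU.mem_nhds hsU))
  exact (h1.congr_of_eventuallyEq (hs.mono fun _ hr => hr.symm)).unique (hasDerivAt_const _ _)

lemma eventually_axis_ne_zero {g : E13 → ℝ} (hg : ContinuousAt g 0) (hg0 : g 0 ≠ 0)
    (k : Fin 13) : ∀ᶠ s : ℝ in nhds 0, g (s • e k) ≠ 0 := by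
  have hline : Filter.Tendsto (fun s : ℝ => s • e k) (nhds 0) (nhds 0) :=
    Continuous.tendsto' (by fun_prop) _ _ (zero_smul ℝ _)
  exact hline.eventually (hg.eventually_ne hg0)

/-- If `g · F` is affine along an axis and `F` vanishes to second order at `0`, then `F` vanishes
near `0` along that axis. -/
lemma eventually_axis_eq_zero {F g : E13 → ℝ} {k : Fin 13} {a b : ℝ}
    (hF : DifferentiableAt ℝ F 0) (hg : DifferentiableAt ℝ g 0) (hg0 : g 0 ≠ 0) (hF0 : F 0 = 0)
    (hdF : pd F k 0 = 0)
    (h : ∀ᶠ s : ℝ in nhds 0, a + b * s = g (s • e k) * F (s • e k)) :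
    ∀ᶠ s : ℝ in nhds 0, F (s • e k) = 0 := by
  have ha : a = 0 := by simpa [hF0] using h.self_of_nhds
  have hb : b = 0 := by
    have h1 := hasDerivAt_axis (k := k) (s := 0) (by simpa using hF)
    have h2 := hasDerivAt_axis (k := k) (s := 0) (by simpa using hg)
    have h3 : HasDerivAt (fun s : ℝ => a + b * s) b 0 := by
      simpa using ((hasDerivAt_id (0 : ℝ)).const_mul b).const_add a
    simpa [hF0, hdF] using
      (h3.congr_of_eventuallyEq (h.mono fun _ hs => hs.symm)).unique (h2.mul h1)
  filter_upwards [h, eventually_axis_ne_zero hg.continuousAt hg0 k] with s hs hgs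
  have : g (s • e k) * F (s • e k) = 0 := by rw [← hs, ha, hb]; ring
  exact (mul_eq_zero.mp this).resolve_left hgs

lemma fderiv_Z_eq_sum_pd (F : E13 → ℝ) (a : ℝ) (p : E13) :
    fderiv ℝ F p (Z a p) = pd F 9 p + (a + p 12) * pd F 10 p +
      p 11 * (pd F 5 p + p 8 * pd F 6 p + (1 + p 9) * pd F 7 p + (1 + p 10) * pd F 8 p +
        p 7 * (pd F 3 p + p 6 * pd F 4 p +
          p 5 * (pd F 0 p + p 3 * pd F 1 p + p 4 * pd F 2 p))) := by
  simp only [Z, pd, map_add, map_smul, smul_eq_mul]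

lemma apply_eq_zero_of_mem_span {v : E13} (hv : v ∈ Submodule.span ℝ ({e 11, e 12} : Set E13))
    {i : Fin 13} (h11 : i ≠ 11) (h12 : i ≠ 12) : v i = 0 := by
  obtain ⟨a, b, rfl⟩ := Submodule.mem_span_pair.mp hv
  simp [e, h11, h12]

/-- Under the stated hypotheses on `Φ` and `f`, necessarily `c = c'`. -/
theorem conjugation_forces_equal_parameters_12212 (c c' : ℝ)
    (Φ : E13 → E13) (U : Set E13) (hU : IsOpen U) (h0U : (0 : E13) ∈ U)
    (hΦsmooth : ContDiffOn ℝ (⊤ : ℕ∞) Φ U) (hΦ0 : Φ 0 = 0)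
    (hdiffeo : Function.Bijective (fderiv ℝ Φ 0))
    -- the components `T, X0, Y0` (indices 0,1,2) depend only on `t, x0, y0`
    (htri0 : ∀ p q : E13, (∀ k : Fin 13, (k : ℕ) ≤ 2 → p k = q k) →
      ∀ i : Fin 13, (i : ℕ) ≤ 2 → Φ p i = Φ q i)
    -- for `1 ≤ j ≤ 5`, the components `Xj, Yj` (indices 2j+1, 2j+2)
    -- depend only on `t, x0, y0, x1, y1, ..., xj, yj`
    (htri : ∀ j : ℕ, 1 ≤ j → j ≤ 5 → ∀ p q : E13,
      (∀ k : Fin 13, (k : ℕ) ≤ 2 * j + 2 → p k = q k) →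
      ∀ i : Fin 13, ((i : ℕ) = 2 * j + 1 ∨ (i : ℕ) = 2 * j + 2) → Φ p i = Φ q i)
    (K H G : E13 → ℝ)
    (hKs : ContDiffOn ℝ (⊤ : ℕ∞) K U) (hHs : ContDiffOn ℝ (⊤ : ℕ∞) H U) (hGs : ContDiffOn ℝ (⊤ : ℕ∞) G U)
    (hK0 : K 0 ≠ 0) (hH0 : H 0 ≠ 0) (hG0 : G 0 ≠ 0)
    -- `X2 = x2·K`, `X3 = x3·H`, `X5 = x5·G`
    (hX2 : ∀ p ∈ U, Φ p 5 = p 5 * K p)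
    (hX3 : ∀ p ∈ U, Φ p 7 = p 7 * H p)
    (hX5 : ∀ p ∈ U, Φ p 11 = p 11 * G p)
    (f : E13 → ℝ) (hfs : ContDiffOn ℝ (⊤ : ℕ∞) f U) (hf0 : f 0 ≠ 0)
    -- `dΦ(p)·Z_{1,c}(p) − f(p)·Z_{1,c'}(Φ(p)) ∈ span{∂_{x5}, ∂_{y5}}` near 0
    (hconj : ∀ p ∈ U, fderiv ℝ Φ p (Z c p) - f p • Z c' (Φ p) ∈
      Submodule.span ℝ ({e 11, e 12} : Set E13)) :
    c = c' := by
  have hinv : ∀ i k : Fin 13, 2 * (((i : ℕ) - 1) / 2) + 2 < (k : ℕ) →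
      ∀ (p : E13) (s : ℝ), Φ (p + s • e k) i = Φ p i := by
    intro i k hik p s
    have hcoord : ∀ m : Fin 13, (m : ℕ) < k → (p + s • e k) m = p m := by
      intro m hm
      have hne : m ≠ k := fun h => by simp [h] at hm
      simp [e, hne]
    by_cases hi : (i : ℕ) ≤ 2
    · exact htri0 _ _ (fun m hm => hcoord m (by omega)) i hi
    · exact htri (((i : ℕ) - 1) / 2) (by omega) (by omega) _ _
        (fun m hm => hcoord m (by omega)) i (by omega)
  have hFs : ∀ i, ContDiffOn ℝ (⊤ : ℕ∞) (fun p => Φ p i) U := contDiffOn_pi.mp hΦsmooth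
  have hFdiff : ∀ i, DifferentiableOn ℝ (fun p => Φ p i) U := fun i =>
    (hFs i).differentiableOn (by simp)
  have hF0 : ∀ i, DifferentiableAt ℝ (fun p => Φ p i) 0 := fun i =>
    (hFdiff i).differentiableAt (hU.mem_nhds h0U)
  have hFc : ∀ i, ContinuousOn (fun p => Φ p i) U := fun i => (hFs i).continuousOn
  have hpdc : ∀ i k, ContinuousOn (pd (fun p => Φ p i) k) U := fun i k =>
    ((hFs i).continuousOn_fderiv_of_isOpen hU (by simp)).clm_apply continuousOn_const
  have hpd0 : ∀ i k : Fin 13, 2 * (((i : ℕ) - 1) / 2) + 2 < (k : ℕ) →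
      ∀ p, pd (fun p => Φ p i) k p = 0 := fun i k hik => pd_eq_zero_of_invariant (hinv i k hik)
  have hpds : ∀ i k : Fin 13, 2 * (((i : ℕ) - 1) / 2) + 2 < (k : ℕ) → ∀ (j : Fin 13) (s : ℝ),
      pd (fun p => Φ p i) j (s • e k) = pd (fun p => Φ p i) j 0 :=
    fun i k hik => pd_smul_of_invariant (hinv i k hik)
  have hcomp : ∀ i : Fin 13, i ≠ 11 → i ≠ 12 → ∀ p ∈ U,
      fderiv ℝ (fun q => Φ q i) p (Z c p) = f p * Z c' (Φ p) i := by
    intro i h11 h12 p hp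
    have hd : DifferentiableAt ℝ Φ p :=
      (hΦsmooth.differentiableOn (by simp)).differentiableAt (hU.mem_nhds hp)
    have h := apply_eq_zero_of_mem_span (hconj p hp) h11 h12
    have happ : fderiv ℝ (fun q => Φ q i) p (Z c p) = fderiv ℝ Φ p (Z c p) i := by
      rw [fderiv_apply hd]; rfl
    rw [happ]
    simpa [sub_eq_zero] using h
  simp only [fderiv_Z_eq_sum_pd] at hcomp
  have hfc := hfs.continuousOn
  have hGc := hGs.continuousOn
  have hHc := hHs.continuousOn
  have hKc := hKs.continuousOn
  have hdiff : ∀ {g : E13 → ℝ}, ContDiffOn ℝ (⊤ : ℕ∞) g U → DifferentiableAt ℝ g 0 :=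
    fun hg => (hg.differentiableOn (by simp)).differentiableAt (hU.mem_nhds h0U)
  have hfGs : ContDiffOn ℝ (⊤ : ℕ∞) (fun p => f p * G p) U := hfs.mul hGs
  have hfGHs : ContDiffOn ℝ (⊤ : ℕ∞) (fun p => f p * G p * H p) U := hfGs.mul hHs
  have hfGHKs : ContDiffOn ℝ (⊤ : ℕ∞) (fun p => f p * G p * H p * K p) U := hfGHs.mul hKs
  have hfG0 : f 0 * G 0 ≠ 0 := mul_ne_zero hf0 hG0
  have hfGH0 : f 0 * G 0 * H 0 ≠ 0 := mul_ne_zero hfG0 hH0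
  have hfGHK0 : f 0 * G 0 * H 0 * K 0 ≠ 0 := mul_ne_zero hfGH0 hK0
  -- the component equations, with the common monomial factors divided out
  have hY0 : ∀ p ∈ U, pd (fun q => Φ q 2) 0 p + p 3 * pd (fun q => Φ q 2) 1 p +
      p 4 * pd (fun q => Φ q 2) 2 p = f p * G p * H p * K p * Φ p 4 := by
    have c0 := hpdc 2 0
    have c1 := hpdc 2 1
    have c2 := hpdc 2 2
    have := hFc 4
    refine eqOn_of_coord_mul_eq hU 5 (by fun_prop) (by fun_prop) ?_
    refine eqOn_of_coord_mul_eq hU 7 (by fun_prop) (by fun_prop) ?_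
    refine eqOn_of_coord_mul_eq hU 11 (by fun_prop) (by fun_prop) fun p hp => ?_
    have h := hcomp 2 (by decide) (by decide) p hp
    simp [hpd0 2, Z, e, hX2 p hp, hX3 p hp, hX5 p hp] at h
    linear_combination h
  have hY1 : ∀ p ∈ U, pd (fun q => Φ q 4) 3 p + p 6 * pd (fun q => Φ q 4) 4 p +
      p 5 * (pd (fun q => Φ q 4) 0 p + p 3 * pd (fun q => Φ q 4) 1 p +
        p 4 * pd (fun q => Φ q 4) 2 p) = f p * G p * H p * Φ p 6 := by
    have c0 := hpdc 4 0
    have c1 := hpdc 4 1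
    have c2 := hpdc 4 2
    have c3 := hpdc 4 3
    have c4 := hpdc 4 4
    have := hFc 6
    refine eqOn_of_coord_mul_eq hU 7 (by fun_prop) (by fun_prop) ?_
    refine eqOn_of_coord_mul_eq hU 11 (by fun_prop) (by fun_prop) fun p hp => ?_
    have h := hcomp 4 (by decide) (by decide) p hp
    simp [hpd0 4, Z, e, hX3 p hp, hX5 p hp] at h
    linear_combination h
  have hW : ∀ i : Fin 13, i = 5 ∨ i = 6 ∨ i = 7 ∨ i = 8 → ∀ p ∈ U,
      pd (fun q => Φ q i) 5 p + p 8 * pd (fun q => Φ q i) 6 p +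
        (1 + p 9) * pd (fun q => Φ q i) 7 p + (1 + p 10) * pd (fun q => Φ q i) 8 p +
        p 7 * (pd (fun q => Φ q i) 3 p + p 6 * pd (fun q => Φ q i) 4 p +
          p 5 * (pd (fun q => Φ q i) 0 p + p 3 * pd (fun q => Φ q i) 1 p +
            p 4 * pd (fun q => Φ q i) 2 p)) =
      f p * G p * (if i = 5 then 1 else if i = 6 then Φ p 8 else if i = 7 then 1 + Φ p 9
        else 1 + Φ p 10) := by
    intro i hi
    have c0 := hpdc i 0
    have c1 := hpdc i 1
    have c2 := hpdc i 2
    have c3 := hpdc i 3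
    have c4 := hpdc i 4
    have c5 := hpdc i 5
    have c6 := hpdc i 6
    have c7 := hpdc i 7
    have c8 := hpdc i 8
    have d8 := hFc 8
    have d9 := hFc 9
    have d10 := hFc 10
    refine eqOn_of_coord_mul_eq hU 11 (by fun_prop) ?_ fun p hp => ?_
    · rcases hi with rfl | rfl | rfl | rfl <;> simp <;> fun_prop
    · have h9 : pd (fun q => Φ q i) 9 p = 0 :=
        hpd0 i 9 (by rcases hi with rfl | rfl | rfl | rfl <;> decide) p
      have h10 : pd (fun q => Φ q i) 10 p = 0 :=
        hpd0 i 10 (by rcases hi with rfl | rfl | rfl | rfl <;> decide) p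
      have h := hcomp i (by rcases hi with rfl | rfl | rfl | rfl <;> decide)
        (by rcases hi with rfl | rfl | rfl | rfl <;> decide) p hp
      rw [h9, h10] at h
      rcases hi with rfl | rfl | rfl | rfl <;> simp [Z, e, hX5 p hp, -mul_eq_mul_left_iff] at h ⊢ <;>
        linear_combination h
  have hX2eq := hW 5 (by decide)
  have hY2eq := hW 6 (by decide)
  have hX3eq := hW 7 (by decide)
  have hY3eq := hW 8 (by decide)
  simp only [reduceIte, Fin.reduceEq] at hX2eq hY2eq hX3eq hY3eq
  clear hW
  have haxis : ∀ k : Fin 13, ∀ᶠ s : ℝ in nhds 0, s • e k ∈ U := fun k =>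
    (show Continuous fun s : ℝ => s • e k by fun_prop).continuousAt.eventually
      (hU.mem_nhds (by simpa using h0U))
  have hΦ0' : ∀ i, Φ 0 i = 0 := fun i => by rw [hΦ0]; rfl
  -- `Y1`, `Y2` vanish on the `x1`-axis
  have hY1x1 : pd (fun q => Φ q 4) 3 0 = 0 := by simpa [hΦ0'] using hY1 0 h0U
  have hY1axis : ∀ᶠ s : ℝ in nhds 0, Φ (s • e 3) 4 = 0 := by
    refine eventually_axis_eq_zero (F := fun q => Φ q 4) (hF0 4) (hdiff hfGHKs) hfGHK0 (hΦ0' 4)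
      hY1x1 (a := pd (fun q => Φ q 2) 0 0) (b := pd (fun q => Φ q 2) 1 0) ?_
    filter_upwards [haxis 3] with s hs
    have h := hY0 _ hs
    simp only [hpds 2 3 (by decide)] at h
    simp [e] at h ⊢
    linear_combination h
  have hY2x1 : pd (fun q => Φ q 6) 3 0 = 0 := by
    refine pd_zero_of_axis_eq (hF0 6) ?_
    have hne : ∀ᶠ s : ℝ in nhds 0, f (s • e 3) * G (s • e 3) * H (s • e 3) ≠ 0 :=
      eventually_axis_ne_zero (hdiff hfGHs).continuousAt hfGH0 3
    filter_upwards [haxis 3, hne, eventually_pd_axis_eq_zero hU h0U (hFdiff 4) hY1axis]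
      with s hs hgs hpd
    have h := hY1 _ hs
    rw [hpd] at h
    have h' : f (s • e 3) * G (s • e 3) * H (s • e 3) * Φ (s • e 3) 6 = 0 := by
      rw [← h]; simp [e]
    rw [(mul_eq_zero.mp h').resolve_left hgs, zero_mul]
  -- `Y2`, `Y3` vanish on the `x2`-axis
  have hY2x2 : pd (fun q => Φ q 6) 5 0 = 0 := by
    simpa [hΦ0', hpd0 6] using hY2eq 0 h0U
  have hY2axis : ∀ᶠ s : ℝ in nhds 0, Φ (s • e 5) 6 = 0 := by
    refine eventually_axis_eq_zero (F := fun q => Φ q 6) (hF0 6) (hdiff hfGHs) hfGH0 (hΦ0' 6)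
      hY2x2 (a := pd (fun q => Φ q 4) 3 0) (b := pd (fun q => Φ q 4) 0 0) ?_
    filter_upwards [haxis 5] with s hs
    have h := hY1 _ hs
    simp only [hpds 4 5 (by decide)] at h
    simp [e] at h ⊢
    linear_combination h
  have hfGne : ∀ k : Fin 13, ∀ᶠ s : ℝ in nhds 0, f (s • e k) * G (s • e k) ≠ 0 := fun k =>
    eventually_axis_ne_zero (hdiff hfGs).continuousAt hfG0 k
  have hY3x2 : pd (fun q => Φ q 8) 5 0 = 0 := by
    refine pd_zero_of_axis_eq (hF0 8) ?_
    filter_upwards [haxis 5, hfGne 5, eventually_pd_axis_eq_zero hU h0U (hFdiff 6) hY2axis]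
      with s hs hgs hpd
    have h := hY2eq _ hs
    rw [hpd] at h
    have h' : f (s • e 5) * G (s • e 5) * Φ (s • e 5) 8 = 0 := by
      rw [← h]; simp [e, hpd0 6]
    rw [(mul_eq_zero.mp h').resolve_left hgs, zero_mul]
  have hY3x3 : pd (fun q => Φ q 8) 7 0 = 0 := by
    refine pd_zero_of_axis_eq (hF0 8) ?_
    filter_upwards [haxis 7, hfGne 7] with s hs hgs
    have h := hY2eq _ hs
    simp only [hpds 6 7 (by decide), hY2x2, hY2x1] at h
    have h' : f (s • e 7) * G (s • e 7) * Φ (s • e 7) 8 = 0 := by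
      rw [← h]; simp [e, hpd0 6]
    rw [(mul_eq_zero.mp h').resolve_left hgs, zero_mul]
  -- normalisation of the linear parts of `X4` and `Y4`
  have hX3pd : ∀ k : Fin 13, k ≠ 7 → pd (fun q => Φ q 7) k 0 = 0 := by
    intro k hk
    refine pd_zero_of_axis_eq (hF0 7) ?_
    filter_upwards [haxis k] with s hs
    rw [hX3 _ hs]
    simp [e, hk.symm]
  have hX3zero := hX3eq 0 h0U
  have hY3zero := hY3eq 0 h0U
  have hX3x2 := hX3pd 5 (by decide)
  have hX3y3 := hX3pd 8 (by decide)
  simp [hΦ0', hX3x2, hX3y3] at hX3zero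
  simp [hΦ0', hY3x2, hY3x3] at hY3zero
  have hfGaxis : ∀ k : Fin 13, k = 9 ∨ k = 10 → ∀ᶠ s : ℝ in nhds 0,
      f (s • e k) * G (s • e k) = f 0 * G 0 := by
    intro k hk
    filter_upwards [haxis k] with s hs
    have h := hX2eq _ hs
    have h0 := hX2eq 0 h0U
    rcases hk with rfl | rfl <;> simp [hpd0 5, e] at h h0 <;>
      exact h.symm.trans ((hpds 5 _ (by decide) 5 s).trans h0)
  have hX4x4 : pd (fun q => Φ q 9) 9 0 = 1 := by
    refine pd_zero_of_axis_eq (hF0 9) ?_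
    filter_upwards [haxis 9, hfGaxis 9 (by decide)] with s hs hfG
    have h := hX3eq _ hs
    simp only [hfG, hpds 7 9 (by decide), hX3x2, hX3y3, hX3zero] at h
    simp [e] at h ⊢
    exact mul_left_cancel₀ hfG0 (by linear_combination -h)
  have hX4y4 : pd (fun q => Φ q 9) 10 0 = 0 := by
    refine pd_zero_of_axis_eq (hF0 9) ?_
    filter_upwards [haxis 10, hfGaxis 10 (by decide)] with s hs hfG
    have h := hX3eq _ hs
    simp only [hfG, hpds 7 10 (by decide), hX3x2, hX3y3, hX3zero] at h
    simp only [e] at h ⊢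
    simp at h ⊢
    exact mul_left_cancel₀ hfG0 (by linear_combination -h)
  have hY4x4 : pd (fun q => Φ q 10) 9 0 = 0 := by
    refine pd_zero_of_axis_eq (hF0 10) ?_
    filter_upwards [haxis 9, hfGaxis 9 (by decide)] with s hs hfG
    have h := hY3eq _ hs
    simp only [hfG, hpds 8 9 (by decide), hY3x2, hY3x3, hY3zero] at h
    simp only [e] at h ⊢
    simp at h ⊢
    exact mul_left_cancel₀ hfG0 (by linear_combination -h)
  have hY4y4 : pd (fun q => Φ q 10) 10 0 = 1 := by
    refine pd_zero_of_axis_eq (hF0 10) ?_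
    filter_upwards [haxis 10, hfGaxis 10 (by decide)] with s hs hfG
    have h := hY3eq _ hs
    simp only [hfG, hpds 8 10 (by decide), hY3x2, hY3x3, hY3zero] at h
    simp [e] at h ⊢
    exact mul_left_cancel₀ hfG0 (by linear_combination -h)
  have hX4eq := hcomp 9 (by decide) (by decide) 0 h0U
  have hY4eq := hcomp 10 (by decide) (by decide) 0 h0U
  simp [Z, e, hΦ0', hX4x4, hX4y4] at hX4eq
  simpa [Z, e, hΦ0', hY4x4, hY4y4, ← hX4eq] using hY4eq
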